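/- Let M be the 6×6 matrix over ℤ[q] with rows: row 1: (q⁴+q³−q²−q, q³−q, q⁵−2q⁴−q³+2q², q⁵−q³, q⁶−2q⁵−q⁴+2q, −2q⁴−q³+2q²+q); row 2: (q³−q, q⁴+q³−q²−q, q⁵−q³, q⁵−2q⁴−q³+2q², q⁶−2q⁵−q⁴+2q, −2q⁴−q³+2q²+q); row 3: (q³−2q², q³, q⁵+q⁴−3q³+3q², q⁵−3q³, q⁶−2q⁵−3q⁴+4q³, −2q⁴+2q³); row 4: (q³, q³−2q², q⁵−3q³, q⁵+q⁴−3q³+3q², q⁶−2q⁵−3q⁴+4q³, −2q⁴+2q³); row 5: (q³, q³, q⁵−3q³, q⁵−3q³, q⁶−2q⁵−2q⁴+4q³+q², −2q⁴); row 6: (−1, −1, 2q², 2q², −4q²+2, q⁴−2q²+2q+1). For g ≥ 0 set v^g = M^g·(1,0,0,0,0,0)ᵗ and write v^g = (ẽ₀^g, ẽ₁^g, ẽ₂^g, ẽ₃^g, ã^g, b̃^g). For g ≥ 1 let m₄^g = (q²+q)(q³−q)^{2g−2} + (q+1)(q²−1)^{2g−2} − q(q²−q)^{2g−2} in ℤ[q].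 Then for every g ≥ 1, the identity ã^g + b̃^g = (q−1)·m₄^g holds in ℤ[q]. -/

import Mathlib

open Polynomial Matrix

noncomputable section

/-- The indeterminate `q` of `ℤ[q]`. -/
def q : Polynomial ℤ := Polynomial.X

/-- The transition matrix `M` of the genus-adding handle attachment. -/
def M : Matrix (Fin 6) (Fin 6) (Polynomial ℤ) :=
  !![q^4+q^3-q^2-q, q^3-q, q^5-2*q^4-q^3+2*q^2, q^5-q^3, q^6-2*q^5-q^4+2*q, -2*q^4-q^3+2*q^2+q;
     q^3-q, q^4+q^3-q^2-q, q^5-q^3, q^5-2*q^4-q^3+2*q^2, q^6-2*q^5-q^4+2*q, -2*q^4-q^3+2*q^2+q;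
     q^3-2*q^2, q^3, q^5+q^4-3*q^3+3*q^2, q^5-3*q^3, q^6-2*q^5-3*q^4+4*q^3, -2*q^4+2*q^3;
     q^3, q^3-2*q^2, q^5-3*q^3, q^5+q^4-3*q^3+3*q^2, q^6-2*q^5-3*q^4+4*q^3, -2*q^4+2*q^3;
     q^3, q^3, q^5-3*q^3, q^5-3*q^3, q^6-2*q^5-2*q^4+4*q^3+q^2, -2*q^4;
     -1, -1, 2*q^2, 2*q^2, -4*q^2+2, q^4-2*q^2+2*q+1]

/-- `v g = M^g · (1,0,0,0,0,0)ᵗ`, whose components are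
`(ẽ₀^g, ẽ₁^g, ẽ₂^g, ẽ₃^g, ã^g, b̃^g)`. -/
def v (g : ℕ) : Fin 6 → Polynomial ℤ :=
  (M ^ g).mulVec ![1, 0, 0, 0, 0, 0]

theorem v_zero : v 0 = ![1, 0, 0, 0, 0, 0] := by
  simp [v]

theorem v_succ (g : ℕ) : v (g + 1) = M.mulVec (v g) := by
  simp only [v, pow_succ', Matrix.mulVec_mulVec]

/-- A left eigenvector of `M` for the eigenvalue `c` evaluates on `v g` to a geometric sequence. -/
theorem dotProduct_v_of_vecMul_eq_smul {w : Fin 6 → Polynomial ℤ} {c : Polynomial ℤ}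
    (h : Matrix.vecMul w M = c • w) (g : ℕ) : w ⬝ᵥ v g = c ^ g * w 0 := by
  induction g with
  | zero => simp [v_zero, dotProduct, Fin.sum_univ_six]
  | succ k ih =>
    rw [v_succ, Matrix.dotProduct_mulVec, h, smul_dotProduct, ih, smul_eq_mul]
    ring

theorem vecMul_M_eq_smul_cubic :
    Matrix.vecMul ![1, 1, q^2-1, q^2-1, q^3-2*q^2-q, -2*q] M =
      (q^3-q)^2 • ![1, 1, q^2-1, q^2-1, q^3-2*q^2-q, -2*q] := by
  ext1 i
  fin_cases i <;> simp [Matrix.vecMul, dotProduct, Fin.sum_univ_six, M] <;> ring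

theorem vecMul_M_eq_smul_sq_sub_one :
    Matrix.vecMul ![1, 1, 0, 0, -2, q^2-2*q-1] M =
      (q^2-1)^2 • ![1, 1, 0, 0, -2, q^2-2*q-1] := by
  ext1 i
  fin_cases i <;> simp [Matrix.vecMul, dotProduct, Fin.sum_univ_six, M] <;> ring

theorem vecMul_M_eq_smul_sq_sub_self :
    Matrix.vecMul ![1, 1, q-1, q-1, -2*q, -2*q] M =
      (q^2-q)^2 • ![1, 1, q-1, q-1, -2*q, -2*q] := by
  ext1 i
  fin_cases i <;> simp [Matrix.vecMul, dotProduct, Fin.sum_univ_six, M] <;> ring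

theorem q_cube_sub_q_ne_zero : q^3 - q ≠ 0 := by
  intro h
  have h2 := congrArg (Polynomial.eval 2) h
  norm_num [q] at h2

theorem stmt_11 (g : ℕ) (hg : 1 ≤ g) :
    v g 4 + v g 5 =
      (q-1) * ((q^2+q)*(q^3-q)^(2*g-2) + (q+1)*(q^2-1)^(2*g-2) - q*(q^2-q)^(2*g-2)) := by
  obtain ⟨k, rfl⟩ : ∃ k, g = k + 1 := ⟨g - 1, by omega⟩
  have hA := dotProduct_v_of_vecMul_eq_smul vecMul_M_eq_smul_cubic (k + 1)
  have hB := dotProduct_v_of_vecMul_eq_smul vecMul_M_eq_smul_sq_sub_one (k + 1)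
  have hC := dotProduct_v_of_vecMul_eq_smul vecMul_M_eq_smul_sq_sub_self (k + 1)
  simp only [dotProduct, Fin.sum_univ_six, Matrix.cons_val] at hA hB hC
  rw [show 2 * (k + 1) - 2 = 2 * k by omega]
  simp only [pow_mul]
  rw [pow_succ] at hA hB hC
  refine mul_left_cancel₀ q_cube_sub_q_ne_zero ?_
  linear_combination hA + q * hB - (q + 1) * hC
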